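/- Let n = 4 and define u_0(x) := |x|^{−1}, u(x) := u_0(x)(1 + (x_1+x_2+x_3+x_4)(1 − ln|x|)/16) for x ∈ B_1 \ {0}, and K(x) := (1 + 3(x_1+x_2+x_3+x_4)(1 − ln|x|)/16 + (x_1+x_2+x_3+x_4)/8) / (1 + (x_1+x_2+x_3+x_4)(1 − ln|x|)/16)^3 for x ∈ B_1 \ {0}, K(0) := 1. Then: u_0 is a C^2 positive solution of −Δu_0 = u_0^3 in B_1 \ {0}; u is a C^2 positive solution of −Δu = K(x) u^3 in B_1 \ {0}; K ∈ C^1(B_1); and ∇K(0) = (1/8, 1/8, 1/8, 1/8). -/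

import Mathlib

open Real Set Metric Filter Function

noncomputable section

/-- The Euclidean Laplacian of `f` at `x`. -/
def lapE {n : ℕ} (f : EuclideanSpace ℝ (Fin n) → ℝ) (x : EuclideanSpace ℝ (Fin n)) : ℝ :=
  ∑ i : Fin n, iteratedFDeriv ℝ 2 f x ![EuclideanSpace.single i 1, EuclideanSpace.single i 1]

/-- The Laplace–Beltrami operator `Δ_θ` on the unit sphere `S^{n-1}`, computed via the
degree-zero homogeneous extension: for `θ` with `‖θ‖ = 1`, `sphLap f θ = Δ_θ f (θ)`. -/
def sphLap {n : ℕ} (f : EuclideanSpace ℝ (Fin n) → ℝ) (θ : EuclideanSpace ℝ (Fin n)) : ℝ :=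
  lapE (fun x => f (‖x‖⁻¹ • x)) θ

/-- Second derivative in the `t` variable. -/
def dtt (g : ℝ → ℝ) : ℝ → ℝ := deriv (deriv g)

/-- Dimension of the space of spherical harmonics on `S^{n-1}` of degree at most `d`. -/
def cumHarm (n d : ℕ) : ℕ := Nat.choose (n - 1 + d) (n - 1) + Nat.choose (n - 2 + d) (n - 1)

/-- The degree of the `i`-th spherical harmonic, eigenfunctions being listed with multiplicity. -/
def sphDeg (n i : ℕ) : ℕ := sInf {d | i < cumHarm n d}

/-- The `i`-th eigenvalue `λ_i` of `-Δ_θ` on `S^{n-1}`, listed in increasing order and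
repeated with multiplicity: `λ_i = d (n + d - 2)` where `d` is the degree of the `i`-th
spherical harmonic.  In particular `λ_0 = 0`, `λ_1 = ⋯ = λ_n = n - 1`, `λ_{n+1} = 2n`. -/
def sphEval (n i : ℕ) : ℝ := (sphDeg n i : ℝ) * ((n : ℝ) + (sphDeg n i : ℝ) - 2)

/-- The linearized operator `L_i = -d²/dt² + λ + (n-2)²/4 - ((n+2)/(n-2)) K(0) ξ^{4/(n-2)}`. -/
def Lop (n : ℕ) (K0 : ℝ) (ξ : ℝ → ℝ) (lam : ℝ) (h : ℝ → ℝ) : ℝ → ℝ :=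
  fun t => -dtt h t
    + (lam + ((n : ℝ) - 2) ^ 2 / 4
        - ((n : ℝ) + 2) / ((n : ℝ) - 2) * K0 * ξ t ^ ((4 : ℝ) / ((n : ℝ) - 2))) * h t

/-- The linearized operator `𝓛_i = -d²/dt² + λ + (n-2a-2)²/4 - (p-1) ζ^{p-2}` for the
Caffarelli-Kohn-Nirenberg equation. -/
def LopCKN (n : ℕ) (a p : ℝ) (ζ : ℝ → ℝ) (lam : ℝ) (h : ℝ → ℝ) : ℝ → ℝ :=
  fun t => -dtt h t + (lam + ((n : ℝ) - 2 * a - 2) ^ 2 / 4 - (p - 1) * ζ t ^ (p - 2)) * h t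

/-- `f, g` is a basis of the kernel of the second-order ODE operator `L` acting on `C²(ℝ)`. -/
def KerBasis (L : (ℝ → ℝ) → ℝ → ℝ) (f g : ℝ → ℝ) : Prop :=
  ContDiff ℝ 2 f ∧ ContDiff ℝ 2 g ∧ (∀ t, L f t = 0) ∧ (∀ t, L g t = 0) ∧
    LinearIndependent ℝ ![f, g] ∧
    ∀ h : ℝ → ℝ, ContDiff ℝ 2 h → (∀ t, L h t = 0) →
      ∃ c₁ c₂ : ℝ, ∀ t, h t = c₁ * f t + c₂ * g t

/-- `ξ` is a positive `T`-periodic solution of the Fowler equation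
`-ξ'' + ((n-2)²/4) ξ = K(0) ξ^{(n+2)/(n-2)}` on `ℝ`. -/
def FowlerXi (n : ℕ) (K0 : ℝ) (ξ : ℝ → ℝ) (T : ℝ) : Prop :=
  ContDiff ℝ 2 ξ ∧ (∀ t, 0 < ξ t) ∧ 0 < T ∧ Function.Periodic ξ T ∧
    ∀ t, -dtt ξ t + ((n : ℝ) - 2) ^ 2 / 4 * ξ t = K0 * ξ t ^ (((n : ℝ) + 2) / ((n : ℝ) - 2))

/-- `ζ` is a positive `T`-periodic solution of `-ζ'' + ((n-2a-2)²/4) ζ = ζ^{p-1}` on `ℝ`. -/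
def ZetaSol (n : ℕ) (a p : ℝ) (ζ : ℝ → ℝ) (T : ℝ) : Prop :=
  ContDiff ℝ 2 ζ ∧ (∀ t, 0 < ζ t) ∧ 0 < T ∧ Function.Periodic ζ T ∧
    ∀ t, -dtt ζ t + ((n : ℝ) - 2 * a - 2) ^ 2 / 4 * ζ t = ζ t ^ (p - 1)

/-- `ρ` is the increasing, divergent sequence of positive exponents such that, for every
`i ≥ 1`, the kernel of the linearized operator `L_i` at the Fowler solution `ξ` has a basis
`e^{-ρ_i t} p_i⁺(t)`, `e^{ρ_i t} p_i⁻(t)` with `p_i^±` smooth and `T`-periodic. -/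
def FowlerExponents (n : ℕ) (K0 : ℝ) (ξ : ℝ → ℝ) (T : ℝ) (ρ : ℕ → ℝ) : Prop :=
  (∀ i, 1 ≤ i → 0 < ρ i) ∧ (∀ i j, 1 ≤ i → i ≤ j → ρ i ≤ ρ j) ∧
    Tendsto ρ atTop atTop ∧
    ∀ i, 1 ≤ i → ∃ p₁ p₂ : ℝ → ℝ, ContDiff ℝ (⊤ : ℕ∞) p₁ ∧ ContDiff ℝ (⊤ : ℕ∞) p₂ ∧
      Function.Periodic p₁ T ∧ Function.Periodic p₂ T ∧
      KerBasis (Lop n K0 ξ (sphEval n i))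
        (fun t => Real.exp (-(ρ i) * t) * p₁ t) (fun t => Real.exp (ρ i * t) * p₂ t)

/-- Analogue of `FowlerExponents` for the CKN linearized operators `𝓛_i`. -/
def CKNExponents (n : ℕ) (a p : ℝ) (ζ : ℝ → ℝ) (T : ℝ) (σ : ℕ → ℝ) : Prop :=
  (∀ i, 1 ≤ i → 0 < σ i) ∧ (∀ i j, 1 ≤ i → i ≤ j → σ i ≤ σ j) ∧
    Tendsto σ atTop atTop ∧
    ∀ i, 1 ≤ i → ∃ q₁ q₂ : ℝ → ℝ, ContDiff ℝ (⊤ : ℕ∞) q₁ ∧ ContDiff ℝ (⊤ : ℕ∞) q₂ ∧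
      Function.Periodic q₁ T ∧ Function.Periodic q₂ T ∧
      KerBasis (LopCKN n a p ζ (sphEval n i))
        (fun t => Real.exp (-(σ i) * t) * q₁ t) (fun t => Real.exp (σ i * t) * q₂ t)

/-- The index set `{ Σ_{i≥1} nᵢ ρᵢ > 0 : nᵢ ∈ ℕ, finitely many nᵢ > 0 }`. -/
def IndexSet (ρ : ℕ → ℝ) : Set ℝ :=
  {s | 0 < s ∧ ∃ f : ℕ →₀ ℕ, (∀ i ∈ f.support, 1 ≤ i) ∧
    s = ∑ i ∈ f.support, (f i : ℝ) * ρ i}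

/-- `v` is a positive solution on `(t₀, ∞) × S^{n-1}` of the cylindrical conformal scalar
curvature equation `-v_tt - Δ_θ v + ((n-2)²/4) v = K(e^{-t}θ) v^{(n+2)/(n-2)}`. -/
def SolCyl (n : ℕ) (K : EuclideanSpace ℝ (Fin n) → ℝ)
    (v : ℝ → EuclideanSpace ℝ (Fin n) → ℝ) (t₀ : ℝ) : Prop :=
  (∀ t θ, t₀ < t → ‖θ‖ = 1 → 0 < v t θ) ∧
    ∀ (t : ℝ) (θ : EuclideanSpace ℝ (Fin n)), t₀ < t → ‖θ‖ = 1 →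
      -dtt (fun s => v s θ) t - sphLap (v t) θ + ((n : ℝ) - 2) ^ 2 / 4 * v t θ
        = K (Real.exp (-t) • θ) * v t θ ^ (((n : ℝ) + 2) / ((n : ℝ) - 2))

/-- `w` is a positive solution on `(t₀, ∞) × S^{n-1}` of the cylindrical CKN equation
`-w_tt - Δ_θ w + ((n-2a-2)²/4) w = w^{p-1}`. -/
def SolCylW (n : ℕ) (a p : ℝ) (w : ℝ → EuclideanSpace ℝ (Fin n) → ℝ) (t₀ : ℝ) : Prop :=
  (∀ t θ, t₀ < t → ‖θ‖ = 1 → 0 < w t θ) ∧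
    ∀ (t : ℝ) (θ : EuclideanSpace ℝ (Fin n)), t₀ < t → ‖θ‖ = 1 →
      -dtt (fun s => w s θ) t - sphLap (w t) θ + ((n : ℝ) - 2 * a - 2) ^ 2 / 4 * w t θ
        = w t θ ^ (p - 1)

/-- `v(t, θ) → ξ(t)` as `t → ∞`, uniformly for `θ ∈ S^{n-1}`. -/
def UnifConv {n : ℕ} (v : ℝ → EuclideanSpace ℝ (Fin n) → ℝ) (ξ : ℝ → ℝ) : Prop :=
  ∀ ε > 0, ∃ T : ℝ, ∀ t ≥ T, ∀ θ : EuclideanSpace ℝ (Fin n), ‖θ‖ = 1 → |v t θ - ξ t| < ε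

/-- The degree-zero homogeneous (in the sphere variable) representative of a function on the
cylinder `ℝ × S^{n-1}`. -/
def cylRep {n : ℕ} (F : ℝ → EuclideanSpace ℝ (Fin n) → ℝ) :
    ℝ × EuclideanSpace ℝ (Fin n) → ℝ :=
  fun pt => F pt.1 (‖pt.2‖⁻¹ • pt.2)

/-- The norm of the intrinsic gradient on the cylinder `ℝ × S^{n-1}` at `(t, θ)`. -/
def cylGrad {n : ℕ} (F : ℝ → EuclideanSpace ℝ (Fin n) → ℝ) (t : ℝ)
    (θ : EuclideanSpace ℝ (Fin n)) : ℝ :=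
  ‖fderiv ℝ (cylRep F) (t, θ)‖

/-- Membership in `C^{2,α}` of a region `s` of the cylinder. -/
def CylC2Holder {n : ℕ} (α : ℝ) (s : Set (ℝ × EuclideanSpace ℝ (Fin n)))
    (F : ℝ → EuclideanSpace ℝ (Fin n) → ℝ) : Prop :=
  ContDiffOn ℝ 2 (cylRep F) s ∧
    ∃ C : ℝ, ∀ p ∈ s, ∀ q ∈ s,
      ‖iteratedFDerivWithin ℝ 2 (cylRep F) s p - iteratedFDerivWithin ℝ 2 (cylRep F) s q‖
        ≤ C * ‖p - q‖ ^ α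

/-- A bounded smooth function on `(t₀, ∞) × S^{n-1}`. -/
def BddSmoothCyl {n : ℕ} (t₀ : ℝ) (c : ℝ → EuclideanSpace ℝ (Fin n) → ℝ) : Prop :=
  ContDiffOn ℝ (⊤ : ℕ∞) (cylRep c)
      ((Ioi t₀) ×ˢ {x : EuclideanSpace ℝ (Fin n) | x ≠ 0}) ∧
    ∃ M : ℝ, ∀ t θ, t₀ < t → ‖θ‖ = 1 → |c t θ| ≤ M

/-- The nonlinear operator `𝓜(f) = -f_tt - Δ_θ f + ((n-2)²/4) f - K f^{(n+2)/(n-2)}`. -/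
def Mop (n : ℕ) (K : EuclideanSpace ℝ (Fin n) → ℝ)
    (f : ℝ → EuclideanSpace ℝ (Fin n) → ℝ) (t : ℝ) (θ : EuclideanSpace ℝ (Fin n)) : ℝ :=
  -dtt (fun s => f s θ) t - sphLap (f t) θ + ((n : ℝ) - 2) ^ 2 / 4 * f t θ
    - K (Real.exp (-t) • θ) * f t θ ^ (((n : ℝ) + 2) / ((n : ℝ) - 2))

/-- The nonlinear operator `𝓝(f) = -f_tt - Δ_θ f + ((n-2a-2)²/4) f - f^{p-1}`. -/
def Nop (n : ℕ) (a p : ℝ)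
    (f : ℝ → EuclideanSpace ℝ (Fin n) → ℝ) (t : ℝ) (θ : EuclideanSpace ℝ (Fin n)) : ℝ :=
  -dtt (fun s => f s θ) t - sphLap (f t) θ + ((n : ℝ) - 2 * a - 2) ^ 2 / 4 * f t θ
    - f t θ ^ (p - 1)

open scoped Classical

/-- `x₁ + x₂ + x₃ + x₄`. -/
def S4 (x : EuclideanSpace ℝ (Fin 4)) : ℝ := x 0 + x 1 + x 2 + x 3

/-- `u₀(x) = |x|⁻¹`. -/
def u0ex (x : EuclideanSpace ℝ (Fin 4)) : ℝ := ‖x‖⁻¹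

/-- `u(x) = u₀(x) (1 + (x₁+⋯+x₄)(1 - ln|x|)/16)`. -/
def uex (x : EuclideanSpace ℝ (Fin 4)) : ℝ :=
  ‖x‖⁻¹ * (1 + S4 x * (1 - Real.log ‖x‖) / 16)

/-- The scalar curvature function of the example. -/
def Kex (x : EuclideanSpace ℝ (Fin 4)) : ℝ :=
  if x = 0 then 1 else
    (1 + 3 * S4 x * (1 - Real.log ‖x‖) / 16 + S4 x / 8)
      / (1 + S4 x * (1 - Real.log ‖x‖) / 16) ^ 3

abbrev E4 := EuclideanSpace ℝ (Fin 4)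

/-- The linear functional `S4`. -/
def S4L : E4 →L[ℝ] ℝ :=
  EuclideanSpace.proj (0 : Fin 4) + EuclideanSpace.proj (1 : Fin 4)
    + EuclideanSpace.proj (2 : Fin 4) + EuclideanSpace.proj (3 : Fin 4)

theorem S4L_apply (x : E4) : S4L x = S4 x := by
  simp [S4L, S4]

theorem hasFDerivAt_nsq (x : E4) :
    HasFDerivAt (fun y : E4 => ‖y‖ ^ 2) ((2 : ℝ) • innerSL ℝ x) x := by
  have h := (hasStrictFDerivAt_norm_sq x).hasFDerivAt
  exact h.congr_fderiv (by ext y; simp)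

theorem nsq_sum (x : E4) : ‖x‖ ^ 2 = x 0 ^ 2 + x 1 ^ 2 + x 2 ^ 2 + x 3 ^ 2 := by
  rw [EuclideanSpace.norm_sq_eq]; simp [Fin.sum_univ_four]

theorem S4_bound (x : E4) : |S4 x| ≤ 2 * ‖x‖ := by
  apply abs_le_of_sq_le_sq _ (by positivity)
  rw [mul_pow, nsq_sum, S4]
  nlinarith [sq_nonneg (x 0 - x 1), sq_nonneg (x 0 - x 2), sq_nonneg (x 0 - x 3),
    sq_nonneg (x 1 - x 2), sq_nonneg (x 1 - x 3), sq_nonneg (x 2 - x 3)]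

/-- First derivative of `a(|x|²) + S(x) b(|x|²)`. -/
theorem hasFDerivAt_gen (a b : ℝ → ℝ) (a1 b1 : ℝ) (x : E4)
    (ha : HasDerivAt a a1 (‖x‖ ^ 2)) (hb : HasDerivAt b b1 (‖x‖ ^ 2)) :
    HasFDerivAt (fun y : E4 => a (‖y‖ ^ 2) + S4 y * b (‖y‖ ^ 2))
      ((2 * a1 + 2 * S4 x * b1) • innerSL ℝ x + b (‖x‖ ^ 2) • S4L) x := by
  have hS : HasFDerivAt (fun y : E4 => S4 y) S4L x := by
    have := S4L.hasFDerivAt (x := x)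
    refine this.congr_of_eventuallyEq (Eventually.of_forall fun y => (S4L_apply y).symm)
  have h1 := ha.comp_hasFDerivAt x (hasFDerivAt_nsq x)
  have h2 := hb.comp_hasFDerivAt x (hasFDerivAt_nsq x)
  refine (h1.add (hS.mul h2)).congr_fderiv ?_
  ext y
  simp
  ring

theorem lap_gen (a b a1 b1 : ℝ → ℝ) (a2 b2 : ℝ) (x : E4) (hx : x ≠ 0)
    (f : E4 → ℝ) (hf : ∀ y, f y = a (‖y‖ ^ 2) + S4 y * b (‖y‖ ^ 2))
    (hC : ContDiffAt ℝ 2 f x)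
    (ha : ∀ s > 0, HasDerivAt a (a1 s) s) (hb : ∀ s > 0, HasDerivAt b (b1 s) s)
    (ha1 : HasDerivAt a1 a2 (‖x‖ ^ 2)) (hb1 : HasDerivAt b1 b2 (‖x‖ ^ 2)) :
    lapE f x = 4 * ‖x‖ ^ 2 * (a2 + S4 x * b2) + 4 * S4 x * b1 (‖x‖ ^ 2)
      + 8 * (a1 (‖x‖ ^ 2) + S4 x * b1 (‖x‖ ^ 2)) := by
  have hf' : f = fun y : E4 => a (‖y‖ ^ 2) + S4 y * b (‖y‖ ^ 2) := funext hf
  have hd : DifferentiableAt ℝ (fderiv ℝ f) x :=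
    (hC.fderiv_right (m := 1) (by norm_num)).differentiableAt (by norm_num)
  have hxp : 0 < ‖x‖ ^ 2 := by positivity
  have key : ∀ i : Fin 4, iteratedFDeriv ℝ 2 f x
      ![EuclideanSpace.single i 1, EuclideanSpace.single i 1] =
      (4 * a2 * x i + 2 * b1 (‖x‖ ^ 2) + 4 * S4 x * b2 * x i) * x i
        + (2 * a1 (‖x‖ ^ 2) + 2 * S4 x * b1 (‖x‖ ^ 2)) + 2 * b1 (‖x‖ ^ 2) * x i := by
    intro i
    set e : E4 := EuclideanSpace.single i 1 with he
    have hSe : S4 e = 1 := by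
      fin_cases i <;> simp [S4, he]
    have hin : ∀ y : E4, inner ℝ y e = y i := by
      intro y; simp [he, EuclideanSpace.inner_single_right]
    rw [iteratedFDeriv_two_apply]
    simp only [Matrix.cons_val_zero, Matrix.cons_val_one]
    have h1 : fderiv ℝ (fderiv ℝ f) x e e = fderiv ℝ (fun y => fderiv ℝ f y e) x e := by
      rw [fderiv_clm_apply hd (differentiableAt_const e)]
      simp
    rw [h1]
    have hev : (fun y => fderiv ℝ f y e) =ᶠ[nhds x] fun y : E4 =>
        (2 * a1 (‖y‖ ^ 2) + 2 * S4 y * b1 (‖y‖ ^ 2)) * y i + b (‖y‖ ^ 2) := by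
      filter_upwards [isOpen_ne.mem_nhds hx] with y hy
      have hy' : y ≠ 0 := hy
      have hyp : 0 < ‖y‖ ^ 2 := by positivity
      rw [hf', (hasFDerivAt_gen a b _ _ y (ha _ hyp) (hb _ hyp)).fderiv]
      simp [hin, S4L_apply, hSe]
    rw [hev.fderiv_eq]
    have h2 := hasFDerivAt_gen a1 b1 _ _ x ha1 hb1
    have h3 : HasFDerivAt (fun y : E4 => y i) (EuclideanSpace.proj (𝕜 := ℝ) i : E4 →L[ℝ] ℝ) x :=
      (EuclideanSpace.proj (𝕜 := ℝ) i : E4 →L[ℝ] ℝ).hasFDerivAt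
    have h4 := (hb _ hxp).comp_hasFDerivAt x (hasFDerivAt_nsq x)
    have h5 := ((h2.const_mul 2).mul h3).add h4
    have h6 : (fun y : E4 =>
        (2 * a1 (‖y‖ ^ 2) + 2 * S4 y * b1 (‖y‖ ^ 2)) * y i + b (‖y‖ ^ 2)) =
        ((fun y : E4 => 2 * (a1 (‖y‖ ^ 2) + S4 y * b1 (‖y‖ ^ 2))) * (fun y : E4 => y i))
          + b ∘ (fun y : E4 => ‖y‖ ^ 2) := by
      funext y; simp only [Pi.add_apply, Pi.mul_apply, Function.comp]; ring
    rw [h6, h5.fderiv]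
    simp [hin, S4L_apply, hSe]
    have : e i = 1 := by simp [he]
    rw [this]
    ring
  unfold lapE
  rw [Finset.sum_congr rfl fun i _ => key i]
  rw [nsq_sum x]
  simp only [Fin.sum_univ_four]
  rw [show S4 x = x 0 + x 1 + x 2 + x 3 from rfl]
  ring

theorem hasDerivAt_q (s : ℝ) (hs : 0 < s) :
    HasDerivAt (fun s : ℝ => (√s)⁻¹) (-(√s)⁻¹ / (2 * s)) s := by
  have h := (Real.hasDerivAt_sqrt hs.ne').inv (Real.sqrt_pos.2 hs).ne'
  refine h.congr_deriv ?_
  rw [Real.sq_sqrt hs.le]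
  field_simp

theorem hasDerivAt_qp (s c d : ℝ) (hs : 0 < s) :
    HasDerivAt (fun s : ℝ => (√s)⁻¹ * (c - d * log s))
      ((√s)⁻¹ / (2 * s) * (-c - 2 * d + d * log s)) s := by
  have h := (hasDerivAt_q s hs).mul (((Real.hasDerivAt_log hs.ne').const_mul d).const_sub c)
  refine h.congr_deriv ?_
  field_simp
  ring

theorem hasDerivAt_qp2 (s c d : ℝ) (hs : 0 < s) :
    HasDerivAt (fun s : ℝ => (√s)⁻¹ / (2 * s) * (c - d * log s))
      ((√s)⁻¹ / (4 * s ^ 2) * (-3 * c - 2 * d + 3 * d * log s)) s := by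
  have h := ((hasDerivAt_qp s c d hs).mul ((hasDerivAt_inv hs.ne'))).div_const 2
  have h6 : (fun s : ℝ => (√s)⁻¹ / (2 * s) * (c - d * log s)) =
     fun s => ((fun s : ℝ => (√s)⁻¹ * (c - d * log s)) * (fun s : ℝ => s⁻¹)) s / 2 := by
    funext s; simp; ring
  rw [h6]
  refine h.congr_deriv ?_
  field_simp
  ring

theorem logn (x : E4) : log (‖x‖ ^ 2) = 2 * log ‖x‖ := by
  rw [Real.log_pow]; norm_num

theorem contDiff_S4 : ContDiff ℝ 2 S4 := by
  have : S4 = fun x => S4L x := funext fun x => (S4L_apply x).symm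
  rw [this]; exact S4L.contDiff

theorem contDiffAt_u0 (x : E4) (hx : x ≠ 0) : ContDiffAt ℝ 2 u0ex x :=
  (contDiffAt_norm ℝ hx).inv (by simpa using hx)

theorem contDiffAt_u (x : E4) (hx : x ≠ 0) : ContDiffAt ℝ 2 uex x := by
  unfold uex
  have h1 := (contDiffAt_norm ℝ hx (n := 2))
  have h2 := h1.inv (by simpa using hx)
  have h3 := h1.log (by simpa using hx)
  exact h2.mul (contDiffAt_const.add
    ((contDiff_S4.contDiffAt.mul (contDiffAt_const.sub h3)).div_const 16))

theorem lap_u0 (x : E4) (hx : x ≠ 0) : -lapE u0ex x = ‖x‖⁻¹ ^ 3 := by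
  have hn : 0 < ‖x‖ := by positivity
  have hxp : 0 < ‖x‖ ^ 2 := by positivity
  have h := lap_gen (fun s => (√s)⁻¹ * (1 - 0 * log s)) (fun _ => 0)
    (fun s => (√s)⁻¹ / (2 * s) * (-1 - 0 * log s)) (fun _ => 0) _ 0 x hx u0ex
    (fun y => by simp [u0ex])
    (contDiffAt_u0 x hx)
    (fun s hs => (hasDerivAt_qp s 1 0 hs).congr_deriv (by ring)) (fun s hs => hasDerivAt_const _ _)
    (hasDerivAt_qp2 _ (-1) 0 hxp) (hasDerivAt_const _ _)
  rw [h]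
  simp only [Real.sqrt_sq hn.le]
  field_simp
  ring

theorem lap_u (x : E4) (hx : x ≠ 0) : -lapE uex x = ‖x‖⁻¹ ^ 3 *
    (1 + 3 * S4 x * (1 - Real.log ‖x‖) / 16 + S4 x / 8) := by
  have hn : 0 < ‖x‖ := by positivity
  have hxp : 0 < ‖x‖ ^ 2 := by positivity
  have h := lap_gen (fun s => (√s)⁻¹ * (1 - 0 * log s))
    (fun s => (√s)⁻¹ * (1 / 16 - 1 / 32 * log s))
    (fun s => (√s)⁻¹ / (2 * s) * (-1 - 0 * log s))
    (fun s => (√s)⁻¹ / (2 * s) * (-1 / 8 - (-1 / 32) * log s)) _ _ x hx uex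
    (fun y => by simp only [uex, logn, Real.sqrt_sq (norm_nonneg y)]; ring)
    (contDiffAt_u x hx)
    (fun s hs => (hasDerivAt_qp s 1 0 hs).congr_deriv (by ring))
    (fun s hs => (hasDerivAt_qp s (1 / 16) (1 / 32) hs).congr_deriv (by ring))
    (hasDerivAt_qp2 _ (-1) 0 hxp) (hasDerivAt_qp2 _ (-1 / 8) (-1 / 32) hxp)
  rw [h]
  simp only [Real.sqrt_sq hn.le, logn]
  field_simp
  ring

/-- The perturbation term. -/
def W4 (x : E4) : ℝ := S4 x * (1 - Real.log ‖x‖) / 16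

theorem hlog (r : ℝ) (h0 : 0 < r) (h1 : r < 1) : r * (1 - log r) ≤ 1 := by
  have := Real.one_sub_inv_le_log_of_pos h0
  have h2 : r * (1 - log r) ≤ r * r⁻¹ := by gcongr; linarith
  rwa [mul_inv_cancel₀ h0.ne'] at h2

theorem W4_bound (x : E4) (h1 : ‖x‖ < 1) :
    |W4 x| ≤ ‖x‖ * (1 - log ‖x‖) / 8 := by
  have hl : log ‖x‖ ≤ 0 := Real.log_nonpos (norm_nonneg x) h1.le
  unfold W4
  rw [abs_div, abs_mul, abs_of_nonneg (by linarith : 0 ≤ 1 - log ‖x‖),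
    abs_of_pos (by norm_num : (0 : ℝ) < 16)]
  nlinarith [mul_le_mul_of_nonneg_right (S4_bound x) (by linarith : 0 ≤ 1 - log ‖x‖)]

theorem W4_small (x : E4) (h1 : ‖x‖ < 1) : |W4 x| ≤ 1 / 8 := by
  by_cases hx : x = 0
  · subst hx; simp [W4, S4]
  · have := W4_bound x h1
    have := hlog ‖x‖ (by positivity) h1
    linarith

theorem hasFDerivAt_W4 (x : E4) (hx : x ≠ 0) :
    HasFDerivAt W4 ((-(S4 x) / (16 * ‖x‖ ^ 2)) • innerSL ℝ x
      + ((1 - log ‖x‖) / 16) • S4L) x := by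
  have hxp : 0 < ‖x‖ ^ 2 := by positivity
  have h := hasFDerivAt_gen (fun _ => 0) (fun s => 1 / 16 - 1 / 32 * log s) 0 _ x
    (hasDerivAt_const _ _) (((Real.hasDerivAt_log hxp.ne').const_mul (1 / 32)).const_sub (1 / 16))
  have hW : W4 = fun y : E4 => 0 + S4 y * (1 / 16 - 1 / 32 * log (‖y‖ ^ 2)) := by
    funext y; rw [logn, W4]; ring
  rw [hW]
  refine h.congr_fderiv ?_
  rw [logn]
  congr 2
  · field_simp; ring
  · ring

theorem Kex_eq (x : E4) : Kex x = (1 + 3 * W4 x + S4 x / 8) / (1 + W4 x) ^ 3 := by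
  unfold Kex
  split_ifs with h
  · subst h; simp [W4, S4]
  · unfold W4; congr 1; ring

/-- The derivative of `Kex`. -/
def K4' (x : E4) : E4 →L[ℝ] ℝ :=
  (1 / (8 * (1 + W4 x) ^ 3)) • S4L - ((6 * W4 x + 3 * S4 x / 8) / (1 + W4 x) ^ 4) •
    ((-(S4 x) / (16 * ‖x‖ ^ 2)) • innerSL ℝ x + ((1 - log ‖x‖) / 16) • S4L)

theorem hasFDerivAt_S4 (x : E4) : HasFDerivAt S4 S4L x := by
  have : S4 = fun x => S4L x := funext fun x => (S4L_apply x).symm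
  rw [this]; exact S4L.hasFDerivAt

theorem hasFDerivAt_K (x : E4) (hx : x ≠ 0) (h1 : ‖x‖ < 1) :
    HasFDerivAt Kex (K4' x) x := by
  have hK : Kex = fun x => (1 + 3 * W4 x + S4 x / 8) * ((1 + W4 x) ^ 3)⁻¹ := by
    funext y; rw [Kex_eq, div_eq_mul_inv]
  have hw := W4_small x h1
  have hpos : 0 < 1 + W4 x := by have := (abs_le.1 hw).1; linarith
  have hW := hasFDerivAt_W4 x hx
  have hN := ((hW.const_mul 3).const_add 1).add ((hasFDerivAt_S4 x).mul_const (1 / 8))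
  have hD := ((hasDerivAt_id (W4 x)).const_add 1).pow 3
  have hD2 := (hD.inv (by simpa using hpos.ne')).comp_hasFDerivAt x hW
  have := hN.mul hD2
  have h7 := this.congr_of_eventuallyEq (f₁ := Kex)
    (Eventually.of_forall fun y => by rw [hK]; simp; left; ring)
  refine h7.congr_fderiv ?_
  ext y
  simp [K4', S4L_apply]
  field_simp
  ring

/-- Modulus of continuity. -/
def M4 (x : E4) : ℝ := ‖x‖ * (1 - log ‖x‖) ^ 2

theorem M4_cont : Continuous M4 := by
  have h : M4 = fun x : E4 => (√‖x‖ - 2 * (√‖x‖ * log √‖x‖)) ^ 2 := by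
    funext x
    have h1 := Real.sq_sqrt (norm_nonneg x)
    have h2 : log ‖x‖ = 2 * log √‖x‖ := by rw [Real.log_sqrt (norm_nonneg x)]; ring
    rw [M4, h2]
    nth_rewrite 1 [← h1]
    ring
  rw [h]
  have h1 : Continuous fun x : E4 => √‖x‖ := by fun_prop
  have h2 := Real.continuous_mul_log.comp h1
  exact (h1.sub (continuous_const.mul h2)).pow 2

theorem M4_tendsto : Tendsto M4 (nhds 0) (nhds 0) := by
  have := M4_cont.tendsto 0
  simpa [M4] using this

theorem K4'_zero : K4' 0 = (1 / 8 : ℝ) • S4L := by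
  simp [K4', W4, S4]

theorem K_est (x : E4) (h1 : ‖x‖ < 1) :
    |Kex x - 1 - S4 x / 8| ≤ 2 * M4 x * ‖x‖ := by
  by_cases hx : x = 0
  · subst hx; simp [Kex, S4]
  have hn : 0 < ‖x‖ := by positivity
  have hl : log ‖x‖ ≤ 0 := Real.log_nonpos (norm_nonneg x) h1.le
  have hs := S4_bound x
  have hw := W4_bound x h1
  have hw1 := W4_small x h1
  have hh := hlog ‖x‖ hn h1
  have hM : M4 x * ‖x‖ = (‖x‖ * (1 - log ‖x‖)) ^ 2 := by rw [M4]; ring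
  have hrh : ‖x‖ ≤ ‖x‖ * (1 - log ‖x‖) := by nlinarith
  rw [mul_assoc, hM, Kex_eq]
  generalize ‖x‖ * (1 - log ‖x‖) = h at *
  generalize W4 x = w at *
  have hσ : |S4 x / 8| ≤ h / 4 := by
    rw [abs_div, abs_of_pos (by norm_num : (0 : ℝ) < 8)]; linarith
  generalize S4 x / 8 = σ at *
  have hwl := (abs_le.1 hw1).1
  have hwu := (abs_le.1 hw1).2
  have hD : 1 / 2 ≤ (1 + w) ^ 3 := by
    have : (7 / 8 : ℝ) ^ 3 ≤ (1 + w) ^ 3 := by gcongr; linarith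
    norm_num at this; linarith
  have hpos : 0 < 1 + w := by linarith
  have e : (1 + 3 * w + σ) / (1 + w) ^ 3 - 1 - σ =
      -(w * w * (3 + w) + σ * w * (3 + 3 * w + w ^ 2)) / (1 + w) ^ 3 := by
    field_simp; ring
  rw [e, abs_div, abs_neg, abs_of_pos (by positivity : 0 < (1 + w) ^ 3), div_le_iff₀ (by positivity)]
  have h3 : |3 + w| ≤ 4 := abs_le.2 ⟨by linarith, by linarith⟩
  have h4 : |3 + 3 * w + w ^ 2| ≤ 4 := abs_le.2 ⟨by nlinarith, by nlinarith⟩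
  have hh0 : 0 ≤ h := by linarith
  calc |w * w * (3 + w) + σ * w * (3 + 3 * w + w ^ 2)|
      ≤ |w * w * (3 + w)| + |σ * w * (3 + 3 * w + w ^ 2)| := abs_add_le _ _
    _ = |w| * |w| * |3 + w| + |σ| * |w| * |3 + 3 * w + w ^ 2| := by simp only [abs_mul]
    _ ≤ h / 8 * (h / 8) * 4 + h / 4 * (h / 8) * 4 := by gcongr
    _ ≤ h ^ 2 := by nlinarith
    _ ≤ 2 * h ^ 2 * (1 + w) ^ 3 := by nlinarith [sq_nonneg h]

theorem hasFDerivAt_K_zero : HasFDerivAt Kex (K4' 0) 0 := by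
  rw [hasFDerivAt_iff_isLittleO_nhds_zero, Asymptotics.isLittleO_iff]
  intro c hc
  have hM := M4_tendsto.eventually (gt_mem_nhds (by positivity : 0 < c / 2))
  filter_upwards [hM, Metric.ball_mem_nhds (0 : E4) one_pos] with x hx hb
  have hb' : ‖x‖ < 1 := by simpa using hb
  have := K_est x hb'
  rw [K4'_zero]
  have h0 : Kex 0 = 1 := by simp [Kex]
  have e : Kex (0 + x) - Kex 0 - ((1 / 8 : ℝ) • S4L) x = Kex x - 1 - S4 x / 8 := by
    simp [h0, S4L_apply]; ring
  rw [e, Real.norm_eq_abs]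
  refine this.trans ?_
  gcongr
  linarith

theorem S4L_norm : ‖S4L‖ ≤ 2 :=
  S4L.opNorm_le_bound (by norm_num) fun x => by
    rw [S4L_apply, Real.norm_eq_abs]; exact S4_bound x

theorem rest_est (x : E4) (h1 : ‖x‖ < 1) :
    ‖((6 * W4 x + 3 * S4 x / 8) / (1 + W4 x) ^ 4) •
    ((-(S4 x) / (16 * ‖x‖ ^ 2)) • innerSL ℝ x + ((1 - log ‖x‖) / 16) • S4L)‖ ≤ M4 x := by
  by_cases hx : x = 0
  · subst hx; simp [W4, S4, M4]
  have hn : 0 < ‖x‖ := by positivity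
  have hl : log ‖x‖ ≤ 0 := Real.log_nonpos (norm_nonneg x) h1.le
  have hs := S4_bound x
  have hw := W4_bound x h1
  have hw1 := W4_small x h1
  have hrh : ‖x‖ ≤ ‖x‖ * (1 - log ‖x‖) := by nlinarith
  have hwl := (abs_le.1 hw1).1
  have hD : 1 / 2 ≤ (1 + W4 x) ^ 4 := by
    have : (7 / 8 : ℝ) ^ 4 ≤ (1 + W4 x) ^ 4 := by gcongr; linarith
    norm_num at this; linarith
  have hA : ‖(6 * W4 x + 3 * S4 x / 8) / (1 + W4 x) ^ 4‖ ≤ 4 * (‖x‖ * (1 - log ‖x‖)) := by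
    rw [Real.norm_eq_abs, abs_div, abs_of_pos (by linarith : 0 < (1 + W4 x) ^ 4),
      div_le_iff₀ (by linarith)]
    have h5 : |6 * W4 x + 3 * S4 x / 8| ≤ 2 * (‖x‖ * (1 - log ‖x‖)) := by
      have a1 := abs_le.1 hs
      have a2 := abs_le.1 hw
      exact abs_le.2 ⟨by linarith [a1.1, a2.1], by linarith [a1.2, a2.2]⟩
    nlinarith [mul_nonneg hn.le (by linarith : 0 ≤ 1 - log ‖x‖)]
  have hB1 : ‖(-(S4 x) / (16 * ‖x‖ ^ 2)) • innerSL ℝ x‖ ≤ 1 / 8 := by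
    rw [norm_smul, innerSL_apply_norm, Real.norm_eq_abs, abs_div, abs_neg,
      abs_of_pos (by positivity : 0 < 16 * ‖x‖ ^ 2), div_mul_eq_mul_div, div_le_iff₀ (by positivity)]
    nlinarith
  have hB2 : ‖((1 - log ‖x‖) / 16) • S4L‖ ≤ (1 - log ‖x‖) / 8 := by
    rw [norm_smul, Real.norm_eq_abs, abs_of_nonneg (by linarith)]
    nlinarith [S4L_norm]
  have hB := (norm_add_le ((-(S4 x) / (16 * ‖x‖ ^ 2)) • innerSL ℝ x)
    (((1 - log ‖x‖) / 16) • S4L)).trans (add_le_add hB1 hB2)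
  rw [norm_smul]
  calc _ ≤ (4 * (‖x‖ * (1 - log ‖x‖))) * ((1 - log ‖x‖) / 4) :=
        mul_le_mul hA (hB.trans (by linarith)) (norm_nonneg _)
          (by have := mul_nonneg hn.le (by linarith : 0 ≤ 1 - log ‖x‖); linarith)
    _ = M4 x := by rw [M4]; ring

theorem W4_contAt (x : E4) : ContinuousAt W4 x := by
  by_cases hx : x = 0
  · subst hx
    have h0 : W4 0 = 0 := by simp [W4, S4]
    rw [ContinuousAt, h0]
    refine squeeze_zero_norm' ?_ M4_tendsto
    filter_upwards [Metric.ball_mem_nhds (0 : E4) one_pos] with x hb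
    have h1 : ‖x‖ < 1 := by simpa using hb
    have hl : log ‖x‖ ≤ 0 := Real.log_nonpos (norm_nonneg x) h1.le
    refine (W4_bound x h1).trans ?_
    rw [M4]
    have : 0 ≤ ‖x‖ * (1 - log ‖x‖) := mul_nonneg (norm_nonneg x) (by linarith)
    nlinarith
  · exact (hasFDerivAt_W4 x hx).continuousAt

theorem K4'_contAt (x : E4) (h1 : ‖x‖ < 1) : ContinuousAt K4' x := by
  have hw := W4_contAt x
  have hpos : 0 < 1 + W4 x := by have := (abs_le.1 (W4_small x h1)).1; linarith
  have hS : Continuous S4 := contDiff_S4.continuous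
  have hc1 : ContinuousAt (fun x => (1 / (8 * (1 + W4 x) ^ 3)) • S4L) x := by
    have h : ContinuousAt (fun x => 1 / (8 * (1 + W4 x) ^ 3)) x := by
      refine ContinuousAt.div ?_ ?_ (by positivity) <;> fun_prop
    exact h.smul (continuousAt_const (y := S4L))
  refine hc1.sub ?_
  by_cases hx : x = 0
  · subst hx
    have h0 : ((6 * W4 0 + 3 * S4 0 / 8) / (1 + W4 0) ^ 4) •
      ((-(S4 0) / (16 * ‖(0 : E4)‖ ^ 2)) • innerSL ℝ (0 : E4)
        + ((1 - log ‖(0 : E4)‖) / 16) • S4L) = 0 := by simp [W4, S4]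
    rw [ContinuousAt, h0]
    refine squeeze_zero_norm' ?_ M4_tendsto
    filter_upwards [Metric.ball_mem_nhds (0 : E4) one_pos] with x hb
    exact rest_est x (by simpa using hb)
  · have hn : ‖x‖ ≠ 0 := by simpa using hx
    have c1 : ContinuousAt (fun x => (6 * W4 x + 3 * S4 x / 8) / (1 + W4 x) ^ 4) x := by
      refine ContinuousAt.div ?_ ?_ (by positivity) <;> fun_prop
    have c2 : ContinuousAt (fun x : E4 => -(S4 x) / (16 * ‖x‖ ^ 2)) x := by
      refine ContinuousAt.div ?_ ?_ (by positivity) <;> fun_prop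
    have c3 : ContinuousAt (fun x : E4 => (1 - log ‖x‖) / 16) x := by
      have := continuous_norm.continuousAt.log hn
      exact (continuousAt_const.sub this).div_const 16
    have c4 : ContinuousAt (fun x : E4 => innerSL ℝ x) x :=
      (innerSL ℝ (E := E4)).continuous.continuousAt
    exact c1.smul ((c2.smul c4).add (c3.smul (continuousAt_const (y := S4L))))

theorem K_contDiffAt (x : E4) (h1 : ‖x‖ < 1) : ContDiffAt ℝ 1 Kex x := by
  rw [contDiffAt_one_iff]
  refine ⟨K4', ball 0 1, isOpen_ball.mem_nhds (by simpa using h1), ?_, ?_⟩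
  · intro y hy
    exact (K4'_contAt y (by simpa using hy)).continuousWithinAt
  · intro y hy
    by_cases h : y = 0
    · subst h; exact hasFDerivAt_K_zero
    · exact hasFDerivAt_K y h (by simpa using hy)

/-- The explicit four-dimensional example showing optimality of the rate
`O(-|x| ln |x|)` when `∇K(0) ≠ 0`. -/
theorem statement_2 :
    ContDiffOn ℝ 2 u0ex (ball (0 : EuclideanSpace ℝ (Fin 4)) 1 \ {0}) ∧
    (∀ x ∈ ball (0 : EuclideanSpace ℝ (Fin 4)) 1 \ {0}, 0 < u0ex x) ∧
    (∀ x ∈ ball (0 : EuclideanSpace ℝ (Fin 4)) 1 \ {0},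
      -lapE u0ex x = u0ex x ^ (3 : ℝ)) ∧
    ContDiffOn ℝ 2 uex (ball (0 : EuclideanSpace ℝ (Fin 4)) 1 \ {0}) ∧
    (∀ x ∈ ball (0 : EuclideanSpace ℝ (Fin 4)) 1 \ {0}, 0 < uex x) ∧
    (∀ x ∈ ball (0 : EuclideanSpace ℝ (Fin 4)) 1 \ {0},
      -lapE uex x = Kex x * uex x ^ (3 : ℝ)) ∧
    ContDiffOn ℝ 1 Kex (ball (0 : EuclideanSpace ℝ (Fin 4)) 1) ∧
    ∀ y : EuclideanSpace ℝ (Fin 4),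
      fderiv ℝ Kex 0 y = (y 0 + y 1 + y 2 + y 3) / 8 := by
  have hball : ∀ x ∈ ball (0 : EuclideanSpace ℝ (Fin 4)) 1 \ {0}, x ≠ 0 ∧ ‖x‖ < 1 := by
    rintro x ⟨h1, h2⟩
    exact ⟨by simpa using h2, by simpa using h1⟩
  have huW : ∀ x, uex x = ‖x‖⁻¹ * (1 + W4 x) := fun x => rfl
  have hpos : ∀ x : E4, ‖x‖ < 1 → 0 < 1 + W4 x := fun x hx => by
    have := (abs_le.1 (W4_small x hx)).1; linarith
  refine ⟨?_, ?_, ?_, ?_, ?_, ?_, ?_, ?_⟩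
  · intro x hx
    exact (contDiffAt_u0 x (hball x hx).1).contDiffWithinAt
  · intro x hx
    have := (hball x hx).1
    unfold u0ex; positivity
  · intro x hx
    rw [lap_u0 x (hball x hx).1, u0ex]
    norm_cast
  · intro x hx
    exact (contDiffAt_u x (hball x hx).1).contDiffWithinAt
  · intro x hx
    have h0 := (hball x hx).1
    have := hpos x (hball x hx).2
    rw [huW]; positivity
  · intro x hx
    have h0 := (hball x hx).1
    have := hpos x (hball x hx).2
    rw [lap_u x h0, huW, Kex_eq, show (3 : ℝ) = ((3 : ℕ) : ℝ) by norm_num, Real.rpow_natCast]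
    have e : 3 * S4 x * (1 - log ‖x‖) / 16 = 3 * W4 x := by unfold W4; ring
    push_cast
    rw [e]
    field_simp
  · intro x hx
    exact (K_contDiffAt x (by simpa using hx)).contDiffWithinAt
  · intro y
    rw [hasFDerivAt_K_zero.fderiv, K4'_zero]
    simp [S4L_apply, S4]
    ring
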